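/- arXiv:1610.08121 — 2 statements merged into one kernel-verified Lean document; each statement's English description precedes it below -/
import Mathlib

section
/- Let (a^V,e^V) and (a^W,e^W) be A-module structures on I×{0,…,N}-graded spaces V and W, with every e^V_{i,n} invertible. Then the map sending a graded homomorphism Φ : V → W to its degree-zero component Φ₀ = (Φ_{i,0})_{i∈I} ∈ L(V₀,W₀) is a linear isomorphism from the space of graded homomorphisms V → W onto the kernel of ∂₀. -/
noncomputable section

/-- Cast of graded components of an `I × ℕ`-graded family of `ℂ`-vector spaces along an
equality of vertices. -/
def lcastN {I : Type} (V : I → ℕ → Type)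
    [∀ i n, AddCommGroup (V i n)] [∀ i n, Module ℂ (V i n)]
    (n : ℕ) {i j : I} (hij : i = j) : V i n ≃ₗ[ℂ] V j n := by
  subst hij; exact LinearEquiv.refl ℂ (V i n)

section Maps

variable {I H : Type}
  (s t : H → I)
  (V W : I → ℕ → Type)
  [∀ i n, AddCommGroup (V i n)] [∀ i n, Module ℂ (V i n)]
  [∀ i n, AddCommGroup (W i n)] [∀ i n, Module ℂ (W i n)]
  (aV : ∀ (h : H) (n : ℕ), V (s h) n →ₗ[ℂ] V (t h) (n + 1))
  (aW : ∀ (h : H) (n : ℕ), W (s h) n →ₗ[ℂ] W (t h) (n + 1))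
  (eW : ∀ (i : I) (n : ℕ), W i n →ₗ[ℂ] W i (n + 1))
  (eVinv : ∀ (i : I) (n : ℕ), V i (n + 1) →ₗ[ℂ] V i n)

/-- The map `∂₀ : L(V₀,W₀) → E(V₀,W₁)`,
`∂₀(φ)_h = a^W_{h,0}∘φ_{s(h)} − e^W_{t(h),0}∘φ_{t(h)}∘(e^V_{t(h),0})⁻¹∘a^V_{h,0}`. -/
def d0 (φ : ∀ i, V i 0 →ₗ[ℂ] W i 0) : ∀ h, V (s h) 0 →ₗ[ℂ] W (t h) 1 :=
  fun h => aW h 0 ∘ₗ φ (s h) - eW (t h) 0 ∘ₗ φ (t h) ∘ₗ eVinv (t h) 0 ∘ₗ aV h 0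

end Maps

/-- For `A`-module structures on `I×{0,…,N}`-graded spaces with the `e^V`
invertible, taking the degree-zero component is a (linear) bijection from the space of graded
homomorphisms `V → W` onto the kernel of `∂₀`. -/
theorem stmt10
    {I H : Type} [Fintype I] [Fintype H] [DecidableEq I]
    (s t : H → I) (bar : H → H)
    (bar_invol : ∀ h, bar (bar h) = h) (bar_ne : ∀ h, bar h ≠ h)
    (s_bar : ∀ h, s (bar h) = t h) (t_bar : ∀ h, t (bar h) = s h)
    (eps : H → ℤ) (eps_pm : ∀ h, eps h = 1 ∨ eps h = -1)
    (eps_bar : ∀ h, eps (bar h) = - eps h)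
    (N : ℕ) (hN : 1 ≤ N)
    (V W : I → ℕ → Type)
    [∀ i n, AddCommGroup (V i n)] [∀ i n, Module ℂ (V i n)]
    [∀ i n, FiniteDimensional ℂ (V i n)]
    [∀ i n, AddCommGroup (W i n)] [∀ i n, Module ℂ (W i n)]
    [∀ i n, FiniteDimensional ℂ (W i n)]
    (aV : ∀ (h : H) (n : ℕ), V (s h) n →ₗ[ℂ] V (t h) (n + 1))
    (eV : ∀ (i : I) (n : ℕ), V i n →ₗ[ℂ] V i (n + 1))
    (aW : ∀ (h : H) (n : ℕ), W (s h) n →ₗ[ℂ] W (t h) (n + 1))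
    (eW : ∀ (i : I) (n : ℕ), W i n →ₗ[ℂ] W i (n + 1))
    -- (R1) for V and W
    (hR1V : ∀ (k : I) (n : ℕ), n + 2 ≤ N →
      (∑ h : H, if hk : s h = k then
        (eps h : ℂ) • ((lcastN V (n + 2) ((t_bar h).trans hk)).toLinearMap
          ∘ₗ aV (bar h) (n + 1) ∘ₗ (lcastN V (n + 1) (s_bar h)).symm.toLinearMap
          ∘ₗ aV h n ∘ₗ (lcastN V n hk).symm.toLinearMap) else 0) = 0)
    (hR1W : ∀ (k : I) (n : ℕ), n + 2 ≤ N →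
      (∑ h : H, if hk : s h = k then
        (eps h : ℂ) • ((lcastN W (n + 2) ((t_bar h).trans hk)).toLinearMap
          ∘ₗ aW (bar h) (n + 1) ∘ₗ (lcastN W (n + 1) (s_bar h)).symm.toLinearMap
          ∘ₗ aW h n ∘ₗ (lcastN W n hk).symm.toLinearMap) else 0) = 0)
    -- (R2) for V and W
    (hR2V : ∀ (h : H) (n : ℕ), n + 2 ≤ N →
      eV (t h) (n + 1) ∘ₗ aV h n = aV h (n + 1) ∘ₗ eV (s h) n)
    (hR2W : ∀ (h : H) (n : ℕ), n + 2 ≤ N →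
      eW (t h) (n + 1) ∘ₗ aW h n = aW h (n + 1) ∘ₗ eW (s h) n)
    -- the e^V are invertible, with inverses eVinv
    (eVinv : ∀ (i : I) (n : ℕ), V i (n + 1) →ₗ[ℂ] V i n)
    (hinv : ∀ (i : I) (n : ℕ), n + 1 ≤ N →
      eVinv i n ∘ₗ eV i n = LinearMap.id ∧ eV i n ∘ₗ eVinv i n = LinearMap.id) :
    Set.BijOn
      (fun (Φ : ∀ (i : I) (n : Fin (N + 1)), V i (n : ℕ) →ₗ[ℂ] W i (n : ℕ)) =>
        (fun i => Φ i ⟨0, by omega⟩ : ∀ i, V i 0 →ₗ[ℂ] W i 0))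
      -- the space of graded homomorphisms V → W
      {Φ | (∀ (i : I) (n : ℕ) (hn : n + 1 ≤ N),
              Φ i ⟨n + 1, by omega⟩ ∘ₗ eV i n = eW i n ∘ₗ Φ i ⟨n, by omega⟩)
        ∧ (∀ (h : H) (n : ℕ) (hn : n + 1 ≤ N),
              Φ (t h) ⟨n + 1, by omega⟩ ∘ₗ aV h n = aW h n ∘ₗ Φ (s h) ⟨n, by omega⟩)}
      -- the kernel of ∂₀
      {φ | d0 s t V W aV aW eW eVinv φ = 0} := by
  have inv1 : ∀ i n, n + 1 ≤ N → ∀ x, eVinv i n (eV i n x) = x := fun i n hn x =>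
    LinearMap.congr_fun (hinv i n hn).1 x
  have inv2 : ∀ i n, n + 1 ≤ N → ∀ x, eV i n (eVinv i n x) = x := fun i n hn x =>
    LinearMap.congr_fun (hinv i n hn).2 x
  have r2V : ∀ h n, n + 2 ≤ N → ∀ x, eV (t h) (n + 1) (aV h n x) = aV h (n + 1) (eV (s h) n x) :=
    fun h n hn x => LinearMap.congr_fun (hR2V h n hn) x
  have r2W : ∀ h n, n + 2 ≤ N → ∀ x, eW (t h) (n + 1) (aW h n x) = aW h (n + 1) (eW (s h) n x) :=
    fun h n hn x => LinearMap.congr_fun (hR2W h n hn) x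
  refine ⟨?_, ?_, ?_⟩
  · rintro Φ ⟨h1, h2⟩
    show d0 s t V W aV aW eW eVinv _ = 0
    funext h
    refine LinearMap.ext fun x => ?_
    have e2 := LinearMap.congr_fun (h2 h 0 hN) x
    have e1 := LinearMap.congr_fun (h1 (t h) 0 hN) (eVinv (t h) 0 (aV h 0 x))
    have e3 := inv2 (t h) 0 hN (aV h 0 x)
    simp only [LinearMap.comp_apply] at e1 e2
    rw [e3] at e1
    exact sub_eq_zero.mpr (e2.symm.trans e1)
  · rintro Φ ⟨h1, -⟩ Ψ ⟨g1, -⟩ h0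
    funext i ⟨n, hn⟩
    induction n with
    | zero => exact congr_fun h0 i
    | succ n ih =>
      refine LinearMap.ext fun x => ?_
      have hn' : n + 1 ≤ N := by omega
      have e1 := LinearMap.congr_fun (h1 i n hn') (eVinv i n x)
      have e2 := LinearMap.congr_fun (g1 i n hn') (eVinv i n x)
      have e3 := inv2 i n hn' x
      have e4 := ih (by omega)
      simp only [LinearMap.comp_apply] at e1 e2
      rw [e3] at e1 e2
      rw [e4] at e1
      exact e1.trans e2.symm
  · intro φ hφ
    let F : ∀ (n : ℕ) (i : I), V i n →ₗ[ℂ] W i n := fun n =>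
      Nat.rec (motive := fun n => ∀ i : I, V i n →ₗ[ℂ] W i n) φ
        (fun n f i => eW i n ∘ₗ f i ∘ₗ eVinv i n) n
    have F1 : ∀ i n, n + 1 ≤ N → ∀ x, F (n + 1) i (eV i n x) = eW i n (F n i x) := by
      intro i n hn x
      show eW i n (F n i (eVinv i n (eV i n x))) = _
      rw [inv1 i n hn]
    have F2 : ∀ h n, n + 1 ≤ N → ∀ x, F (n + 1) (t h) (aV h n x) = aW h n (F n (s h) x) := by
      intro h n
      induction n with
      | zero =>
        intro hn x
        have := LinearMap.congr_fun (congr_fun hφ h) x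
        exact (sub_eq_zero.mp this).symm
      | succ n ih =>
        intro hn x
        obtain ⟨y, rfl⟩ : ∃ y, eV (s h) n y = x := ⟨_, inv2 (s h) n (by omega) x⟩
        rw [← r2V h n hn, F1 _ _ hn, ih (by omega), r2W h n hn, F1 _ _ (by omega)]
    refine ⟨fun i n => F n i, ⟨?_, ?_⟩, rfl⟩
    · intro i n hn
      exact LinearMap.ext fun x => F1 i n hn x
    · intro h n hn
      exact LinearMap.ext fun x => F2 h n hn x
end
end

section
/- Let N ≥ 2 and let (a^V,e^V) and (a^W,e^W) be graded representations on I×{0,…,N}-graded spaces V and W, with every e^V_{i,n} invertible. Let K := { λ ∈ L(W₂,V₀) : for all h ∈ H, λ_{s(h)}∘a^W_{h̄,1} = (e^V_{s(h),0})⁻¹∘a^V_{h̄,0}∘λ_{t(h)}∘e^W_{t(h),1} }. Then, with respect to the nondegenerate trace pairing ⟨λ,μ⟩ = Σ_{i∈I} tr(λ_i∘μ_i) between L(W₂,V₀) and L(V₀,W₂), the image of ∂₁ equals the annihilator of K; consequently the cokernel of ∂₁ is naturally isomorphic to the dual space K*. -/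
noncomputable section

section Maps

variable {I H : Type} [DecidableEq I] [Fintype H]
  (s t : H → I) (bar : H → H)
  (s_bar : ∀ h, s (bar h) = t h) (t_bar : ∀ h, t (bar h) = s h)
  (eps : H → ℤ)
  (V W : I → ℕ → Type)
  [∀ i n, AddCommGroup (V i n)] [∀ i n, Module ℂ (V i n)]
  [∀ i n, AddCommGroup (W i n)] [∀ i n, Module ℂ (W i n)]
  (aV : ∀ (h : H) (n : ℕ), V (s h) n →ₗ[ℂ] V (t h) (n + 1))
  (aW : ∀ (h : H) (n : ℕ), W (s h) n →ₗ[ℂ] W (t h) (n + 1))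
  (eW : ∀ (i : I) (n : ℕ), W i n →ₗ[ℂ] W i (n + 1))
  (eVinv : ∀ (i : I) (n : ℕ), V i (n + 1) →ₗ[ℂ] V i n)

/-- The map `∂₁ : E(V₀,W₁) → L(V₀,W₂)`,
`∂₁(ψ)_k = Σ_{h : t(h) = k} ε(h)( a^W_{h,1}∘ψ_{h̄} + e^W_{k,1}∘ψ_h∘(e^V_{s(h),0})⁻¹∘a^V_{h̄,0} )`,
bundled as a linear map. -/
def d1L : (∀ h, V (s h) 0 →ₗ[ℂ] W (t h) 1) →ₗ[ℂ] (∀ k, V k 0 →ₗ[ℂ] W k 2) :=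
  LinearMap.pi fun k => ∑ h : H, if hk : t h = k then
    (eps h : ℂ) • (
      (LinearMap.llcomp ℂ (V k 0) (W (t (bar h)) 1) (W k 2)
          ((lcastN W 2 hk).toLinearMap ∘ₗ aW h 1 ∘ₗ (lcastN W 1 (t_bar h)).toLinearMap))
        ∘ₗ (LinearMap.lcomp ℂ (W (t (bar h)) 1)
          ((lcastN V 0 ((s_bar h).trans hk)).symm.toLinearMap))
        ∘ₗ (LinearMap.proj (bar h))
      +
      (LinearMap.llcomp ℂ (V k 0) (W (t h) 1) (W k 2)
          ((lcastN W 2 hk).toLinearMap ∘ₗ eW (t h) 1))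
        ∘ₗ (LinearMap.lcomp ℂ (W (t h) 1)
          (eVinv (s h) 0 ∘ₗ (lcastN V 1 (t_bar h)).toLinearMap ∘ₗ aV (bar h) 0
            ∘ₗ (lcastN V 0 ((s_bar h).trans hk)).symm.toLinearMap))
        ∘ₗ (LinearMap.proj h))
  else 0

/-- The subspace `K ⊆ L(W₂,V₀)` of maps `λ` with
`λ_{s(h)}∘a^W_{h̄,1} = (e^V_{s(h),0})⁻¹∘a^V_{h̄,0}∘λ_{t(h)}∘e^W_{t(h),1}` for all `h`. -/
def Ksub : Submodule ℂ (∀ i, W i 2 →ₗ[ℂ] V i 0) :=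
  ⨅ h : H, LinearMap.ker
    ((LinearMap.lcomp ℂ (V (s h) 0)
        ((lcastN W 2 (t_bar h)).toLinearMap ∘ₗ aW (bar h) 1)) ∘ₗ LinearMap.proj (s h)
      -
      ((LinearMap.llcomp ℂ (W (s (bar h)) 1) (V (t h) 0) (V (s h) 0)
          (eVinv (s h) 0 ∘ₗ (lcastN V 1 (t_bar h)).toLinearMap ∘ₗ aV (bar h) 0
            ∘ₗ (lcastN V 0 (s_bar h)).symm.toLinearMap))
        ∘ₗ (LinearMap.lcomp ℂ (V (t h) 0)
            (eW (t h) 1 ∘ₗ (lcastN W 1 (s_bar h)).toLinearMap))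
        ∘ₗ LinearMap.proj (t h)))

end Maps

theorem absPair {L M E : Type*} [AddCommGroup L] [Module ℂ L] [AddCommGroup M] [Module ℂ M]
    [FiniteDimensional ℂ M] [FiniteDimensional ℂ L]
    [AddCommGroup E] [Module ℂ E] (P : L →ₗ[ℂ] M →ₗ[ℂ] ℂ)
    (h1 : Function.Injective P) (h2 : Function.Injective P.flip) (D : E →ₗ[ℂ] M)
    (K : Submodule ℂ L) (hK : ∀ l, l ∈ K ↔ ∀ ψ, P l (D ψ) = 0) :
    ((LinearMap.range D : Set M) = {μ | ∀ l ∈ K, P l μ = 0}) ∧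
    Nonempty ((M ⧸ LinearMap.range D) ≃ₗ[ℂ] Module.Dual ℂ K) := by
  have hp : P.IsPerfPair := LinearMap.IsPerfPair.of_injective h1 h2
  let e : L ≃ₗ[ℂ] Module.Dual ℂ M := LinearEquiv.ofBijective P hp.bijective_left
  have he : ∀ l, e l = P l := fun l => rfl
  have hm : K.map e.toLinearMap = (LinearMap.range D).dualAnnihilator := by
    ext f
    obtain ⟨l, rfl⟩ := e.surjective f
    simp only [Submodule.mem_map, Submodule.mem_dualAnnihilator]
    constructor
    · rintro ⟨l', hl', h⟩ _ ⟨ψ, rfl⟩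
      have : l' = l := e.injective h
      subst this
      exact (hK _).1 hl' ψ
    · intro h
      exact ⟨l, (hK l).2 fun ψ => h _ ⟨ψ, rfl⟩, rfl⟩
  constructor
  · ext μ
    have h := Subspace.dualAnnihilator_dualCoannihilator_eq (W := LinearMap.range D)
    rw [SetLike.mem_coe, ← h, ← hm]
    simp only [Submodule.mem_dualCoannihilator, Submodule.mem_map, Set.mem_ofPred_eq]
    constructor
    · intro H l hl
      exact H _ ⟨l, hl, rfl⟩
    · rintro H _ ⟨l, hl, rfl⟩
      exact H l hl
  · have e1 : K ≃ₗ[ℂ] Module.Dual ℂ (M ⧸ LinearMap.range D) :=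
      (e.submoduleMap K).trans ((LinearEquiv.ofEq _ _ hm).trans
        (LinearMap.range D).dualQuotEquivDualAnnihilator.symm)
    exact ⟨(Module.evalEquiv ℂ _).trans e1.dualMap⟩

theorem tr_smulRight {A B : Type*} [AddCommGroup A] [Module ℂ A] [AddCommGroup B] [Module ℂ B]
    [FiniteDimensional ℂ A] (X : B →ₗ[ℂ] A) (f : A →ₗ[ℂ] ℂ) (w : B) :
    LinearMap.trace ℂ A (X ∘ₗ f.smulRight w) = f (X w) := by
  have : X ∘ₗ f.smulRight w = f.smulRight (X w) := by ext; simp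
  rw [this, LinearMap.trace_smulRight]

theorem tr_nondeg {A B : Type*} [AddCommGroup A] [Module ℂ A] [AddCommGroup B] [Module ℂ B]
    [FiniteDimensional ℂ A] (X : B →ₗ[ℂ] A)
    (h : ∀ Y : A →ₗ[ℂ] B, LinearMap.trace ℂ A (X ∘ₗ Y) = 0) : X = 0 := by
  ext w
  rw [LinearMap.zero_apply, ← Module.forall_dual_apply_eq_zero_iff ℂ]
  intro f
  rw [← tr_smulRight]; exact h _

def trPair {ι : Type} [Fintype ι] (A B : ι → Type)
    [∀ i, AddCommGroup (A i)] [∀ i, Module ℂ (A i)]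
    [∀ i, AddCommGroup (B i)] [∀ i, Module ℂ (B i)] :
    (∀ i, B i →ₗ[ℂ] A i) →ₗ[ℂ] (∀ i, A i →ₗ[ℂ] B i) →ₗ[ℂ] ℂ :=
  LinearMap.mk₂ ℂ (fun l m => ∑ i, LinearMap.trace ℂ (A i) (l i ∘ₗ m i))
    (by intros; simp [LinearMap.add_comp, Finset.sum_add_distrib])
    (by intros; simp [LinearMap.smul_comp, Finset.mul_sum])
    (by intros; simp [LinearMap.comp_add, Finset.sum_add_distrib])
    (by intros; simp [LinearMap.comp_smul, Finset.mul_sum])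

theorem trPair_apply {ι : Type} [Fintype ι] (A B : ι → Type)
    [∀ i, AddCommGroup (A i)] [∀ i, Module ℂ (A i)]
    [∀ i, AddCommGroup (B i)] [∀ i, Module ℂ (B i)]
    (l : ∀ i, B i →ₗ[ℂ] A i) (m : ∀ i, A i →ₗ[ℂ] B i) :
    trPair A B l m = ∑ i, LinearMap.trace ℂ (A i) (l i ∘ₗ m i) := rfl

theorem trPair_nondeg {ι : Type} [Fintype ι] (A B : ι → Type)
    [∀ i, AddCommGroup (A i)] [∀ i, Module ℂ (A i)] [∀ i, FiniteDimensional ℂ (A i)]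
    [∀ i, AddCommGroup (B i)] [∀ i, Module ℂ (B i)]
    (l : ∀ i, B i →ₗ[ℂ] A i) (h : ∀ m, trPair A B l m = 0) : l = 0 := by
  classical
  funext i
  apply tr_nondeg
  intro Y
  have := h (Pi.single i Y)
  rw [trPair_apply, Finset.sum_eq_single i] at this
  · simpa using this
  · intro j _ hj
    simp [hj]
  · simp

theorem trPair_comm {ι : Type} [Fintype ι] (A B : ι → Type)
    [∀ i, AddCommGroup (A i)] [∀ i, Module ℂ (A i)] [∀ i, FiniteDimensional ℂ (A i)]
    [∀ i, AddCommGroup (B i)] [∀ i, Module ℂ (B i)] [∀ i, FiniteDimensional ℂ (B i)]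
    (l : ∀ i, B i →ₗ[ℂ] A i) (m : ∀ i, A i →ₗ[ℂ] B i) :
    trPair A B l m = trPair B A m l := by
  rw [trPair_apply, trPair_apply]
  exact Finset.sum_congr rfl fun i _ => LinearMap.trace_comp_comm' _ _

theorem tr_cast {I : Type} (V W : I → ℕ → Type)
    [∀ i n, AddCommGroup (V i n)] [∀ i n, Module ℂ (V i n)]
    [∀ i n, AddCommGroup (W i n)] [∀ i n, Module ℂ (W i n)]
    (lam : ∀ i, W i 2 →ₗ[ℂ] V i 0) {i j k : I} (e : i = j) (e' : k = i) (e'' : k = j)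
    (X : V k 0 →ₗ[ℂ] W i 2) :
    LinearMap.trace ℂ (V j 0) (lam j ∘ₗ (lcastN W 2 e).toLinearMap ∘ₗ X ∘ₗ
      (lcastN V 0 e'').symm.toLinearMap) =
    LinearMap.trace ℂ (V i 0) (lam i ∘ₗ X ∘ₗ (lcastN V 0 e').symm.toLinearMap) := by
  subst e; rfl

section
variable {I H : Type} [Fintype I] [Fintype H] [DecidableEq I]
    (s t : H → I) (bar : H → H)
    (s_bar : ∀ h, s (bar h) = t h) (t_bar : ∀ h, t (bar h) = s h)
    (eps : H → ℤ)
    (V W : I → ℕ → Type)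
    [∀ i n, AddCommGroup (V i n)] [∀ i n, Module ℂ (V i n)]
    [∀ i n, FiniteDimensional ℂ (V i n)]
    [∀ i n, AddCommGroup (W i n)] [∀ i n, Module ℂ (W i n)]
    [∀ i n, FiniteDimensional ℂ (W i n)]
    (aV : ∀ (h : H) (n : ℕ), V (s h) n →ₗ[ℂ] V (t h) (n + 1))
    (aW : ∀ (h : H) (n : ℕ), W (s h) n →ₗ[ℂ] W (t h) (n + 1))
    (eW : ∀ (i : I) (n : ℕ), W i n →ₗ[ℂ] W i (n + 1))
    (eVinv : ∀ (i : I) (n : ℕ), V i (n + 1) →ₗ[ℂ] V i n)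

/-- The defect of the defining equation of K at h. -/
def defect (lam : ∀ i, W i 2 →ₗ[ℂ] V i 0) (h : H) : W (t h) 1 →ₗ[ℂ] V (s h) 0 :=
  (eVinv (s h) 0 ∘ₗ (lcastN V 1 (t_bar h)).toLinearMap ∘ₗ aV (bar h) 0
            ∘ₗ (lcastN V 0 (s_bar h)).symm.toLinearMap) ∘ₗ lam (t h) ∘ₗ eW (t h) 1
   - lam (s h) ∘ₗ (lcastN W 2 (t_bar h)).toLinearMap ∘ₗ aW (bar h) 1 ∘ₗ
      (lcastN W 1 (s_bar h)).symm.toLinearMap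

theorem mem_K_iff (lam : ∀ i, W i 2 →ₗ[ℂ] V i 0) :
    lam ∈ Ksub s t bar s_bar t_bar V W aV aW eW eVinv ↔
    ∀ h, defect s t bar s_bar t_bar V W aV aW eW eVinv lam h = 0 := by
  simp only [Ksub, Submodule.mem_iInf, LinearMap.mem_ker]
  refine forall_congr' fun h => ?_
  rw [LinearMap.sub_apply, sub_eq_zero, defect, sub_eq_zero]
  constructor
  · intro H
    ext x
    have := LinearMap.congr_fun H ((lcastN W 1 (s_bar h)).symm x)
    simp at this
    simp [this]
  · intro H
    ext x
    have := LinearMap.congr_fun H (lcastN W 1 (s_bar h) x)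
    simp at this
    simp [this]

/-- first term -/
theorem term1 (bar_invol : ∀ h, bar (bar h) = h)
    (lam : ∀ i, W i 2 →ₗ[ℂ] V i 0) (ψ : ∀ h, V (s h) 0 →ₗ[ℂ] W (t h) 1) (h : H) :
    LinearMap.trace ℂ (V (t (bar h)) 0) (lam (t (bar h)) ∘ₗ
      (aW (bar h) 1 ∘ₗ (lcastN W 1 (t_bar (bar h))).toLinearMap ∘ₗ ψ (bar (bar h))) ∘ₗ
      (lcastN V 0 (s_bar (bar h))).symm.toLinearMap) =
    LinearMap.trace ℂ (V (s h) 0) ((lam (s h) ∘ₗ (lcastN W 2 (t_bar h)).toLinearMap ∘ₗ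
      aW (bar h) 1 ∘ₗ (lcastN W 1 (s_bar h)).symm.toLinearMap) ∘ₗ ψ h) := by
  have key : ∀ (g g' : H) (hb : bar g = g') (e1 : t g' = s g) (e2 : s g' = t g),
      LinearMap.trace ℂ (V (t g) 0) (lam (t g) ∘ₗ
      (aW g 1 ∘ₗ (lcastN W 1 (t_bar g)).toLinearMap ∘ₗ ψ (bar g)) ∘ₗ
      (lcastN V 0 (s_bar g)).symm.toLinearMap) =
      LinearMap.trace ℂ (V (t g) 0) (lam (t g) ∘ₗ
      (aW g 1 ∘ₗ (lcastN W 1 e1).toLinearMap ∘ₗ ψ g') ∘ₗ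
      (lcastN V 0 e2).symm.toLinearMap) := by
    intro g g' hb e1 e2
    subst hb; rfl
  rw [key (bar h) h (bar_invol h) (s_bar h).symm (t_bar h).symm,
    ← tr_cast V W lam (t_bar h) _ rfl]
  have hc : ∀ {i j : I} (e : i = j) , lcastN W 1 e.symm = (lcastN W 1 e).symm := by
    intro i j e; subst e; rfl
  rw [hc (s_bar h)]
  rfl

theorem pair_d1 (bar_invol : ∀ h, bar (bar h) = h)
    (eps_bar : ∀ h, eps (bar h) = - eps h)
    (lam : ∀ i, W i 2 →ₗ[ℂ] V i 0) (ψ : ∀ h, V (s h) 0 →ₗ[ℂ] W (t h) 1) :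
    trPair (fun i => V i 0) (fun i => W i 2) lam
      (d1L s t bar s_bar t_bar eps V W aV aW eW eVinv ψ) =
    trPair (fun h => V (s h) 0) (fun h => W (t h) 1)
      (fun h => (eps h : ℂ) • defect s t bar s_bar t_bar V W aV aW eW eVinv lam h) ψ := by
  have step : trPair (fun i => V i 0) (fun i => W i 2) lam
      (d1L s t bar s_bar t_bar eps V W aV aW eW eVinv ψ) =
      ∑ h, ((eps h : ℂ) * LinearMap.trace ℂ (V (t h) 0) (lam (t h) ∘ₗ
        (aW h 1 ∘ₗ (lcastN W 1 (t_bar h)).toLinearMap ∘ₗ ψ (bar h)) ∘ₗ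
        (lcastN V 0 (s_bar h)).symm.toLinearMap) +
        (eps h : ℂ) * LinearMap.trace ℂ (V (t h) 0) (lam (t h) ∘ₗ
        (eW (t h) 1 ∘ₗ ψ h ∘ₗ eVinv (s h) 0 ∘ₗ (lcastN V 1 (t_bar h)).toLinearMap ∘ₗ
          aV (bar h) 0) ∘ₗ (lcastN V 0 (s_bar h)).symm.toLinearMap)) := by
    rw [trPair_apply]
    simp only [d1L, LinearMap.pi_apply, LinearMap.sum_apply]
    have : ∀ (k : I) (X : H → V k 0 →ₗ[ℂ] W k 2), LinearMap.trace ℂ (V k 0)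
        (lam k ∘ₗ ∑ h, X h) = ∑ h, LinearMap.trace ℂ (V k 0) (lam k ∘ₗ X h) := by
      intro k X
      rw [← map_sum]
      congr 1
      ext; simp
    simp only [this]
    rw [Finset.sum_comm]
    refine Finset.sum_congr rfl fun h _ => ?_
    rw [Finset.sum_eq_single (t h)]
    · rw [dif_pos rfl, ← mul_add, ← map_add, ← smul_eq_mul, ← map_smul]
      congr 1
      ext x
      simp [lcastN]
    · intro k _ hk
      rw [dif_neg (Ne.symm hk)]
      simp
    · simp
  have hi : Function.Involutive bar := bar_invol
  rw [step, Finset.sum_add_distrib, trPair_apply,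
    ← Equiv.sum_comp (Function.Involutive.toPerm bar hi), ← Finset.sum_add_distrib]
  refine Finset.sum_congr rfl fun h _ => ?_
  refine (congrArg₂ (· + ·) (congrArg₂ (· * ·) (congrArg (Int.cast : ℤ → ℂ) (eps_bar h))
    (term1 s t bar s_bar t_bar V W aW bar_invol lam ψ h)) rfl).trans ?_
  rw [ LinearMap.smul_comp, map_smul,
    defect, LinearMap.sub_comp, map_sub]
  have : LinearMap.trace ℂ (V (t h) 0) (lam (t h) ∘ₗ
        (eW (t h) 1 ∘ₗ ψ h ∘ₗ eVinv (s h) 0 ∘ₗ (lcastN V 1 (t_bar h)).toLinearMap ∘ₗ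
          aV (bar h) 0) ∘ₗ (lcastN V 0 (s_bar h)).symm.toLinearMap) =
      LinearMap.trace ℂ (V (s h) 0) (((eVinv (s h) 0 ∘ₗ (lcastN V 1 (t_bar h)).toLinearMap ∘ₗ
          aV (bar h) 0 ∘ₗ (lcastN V 0 (s_bar h)).symm.toLinearMap) ∘ₗ lam (t h) ∘ₗ
          eW (t h) 1) ∘ₗ ψ h) :=
    LinearMap.trace_comp_comm' (eVinv (s h) 0 ∘ₗ (lcastN V 1 (t_bar h)).toLinearMap ∘ₗ
          aV (bar h) 0 ∘ₗ (lcastN V 0 (s_bar h)).symm.toLinearMap)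
          (lam (t h) ∘ₗ eW (t h) 1 ∘ₗ ψ h)
  rw [this]
  push_cast
  simp only [smul_eq_mul]
  ring
end

/-- With respect to the trace pairing between `L(W₂,V₀)` and `L(V₀,W₂)`,
the image of `∂₁` is the annihilator of `K`; consequently `coker ∂₁ ≅ K*`. -/
theorem stmt12
    {I H : Type} [Fintype I] [Fintype H] [DecidableEq I]
    (s t : H → I) (bar : H → H)
    (bar_invol : ∀ h, bar (bar h) = h) (bar_ne : ∀ h, bar h ≠ h)
    (s_bar : ∀ h, s (bar h) = t h) (t_bar : ∀ h, t (bar h) = s h)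
    (eps : H → ℤ) (eps_pm : ∀ h, eps h = 1 ∨ eps h = -1)
    (eps_bar : ∀ h, eps (bar h) = - eps h)
    (N : ℕ) (hN : 2 ≤ N)
    (V W : I → ℕ → Type)
    [∀ i n, AddCommGroup (V i n)] [∀ i n, Module ℂ (V i n)]
    [∀ i n, FiniteDimensional ℂ (V i n)]
    [∀ i n, AddCommGroup (W i n)] [∀ i n, Module ℂ (W i n)]
    [∀ i n, FiniteDimensional ℂ (W i n)]
    (aV : ∀ (h : H) (n : ℕ), V (s h) n →ₗ[ℂ] V (t h) (n + 1))
    (eV : ∀ (i : I) (n : ℕ), V i n →ₗ[ℂ] V i (n + 1))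
    (aW : ∀ (h : H) (n : ℕ), W (s h) n →ₗ[ℂ] W (t h) (n + 1))
    (eW : ∀ (i : I) (n : ℕ), W i n →ₗ[ℂ] W i (n + 1))
    -- the e^V are invertible, with inverses eVinv
    (eVinv : ∀ (i : I) (n : ℕ), V i (n + 1) →ₗ[ℂ] V i n)
    (hinv : ∀ (i : I) (n : ℕ), n + 1 ≤ N →
      eVinv i n ∘ₗ eV i n = LinearMap.id ∧ eV i n ∘ₗ eVinv i n = LinearMap.id) :
    -- the image of ∂₁ is the annihilator of K for the trace pairing
    ((LinearMap.range (d1L s t bar s_bar t_bar eps V W aV aW eW eVinv)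
        : Set (∀ k, V k 0 →ₗ[ℂ] W k 2))
      = {μ | ∀ lam ∈ Ksub s t bar s_bar t_bar V W aV aW eW eVinv,
          (∑ i : I, LinearMap.trace ℂ (V i 0) (lam i ∘ₗ μ i)) = 0})
    ∧
    -- consequently, coker ∂₁ is isomorphic to the dual of K
    Nonempty
      (((∀ k, V k 0 →ₗ[ℂ] W k 2)
          ⧸ LinearMap.range (d1L s t bar s_bar t_bar eps V W aV aW eW eVinv))
        ≃ₗ[ℂ] Module.Dual ℂ (Ksub s t bar s_bar t_bar V W aV aW eW eVinv)) := by
  refine absPair (trPair (fun i => V i 0) (fun i => W i 2)) ?_ ?_ _ _ ?_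
  · rw [injective_iff_map_eq_zero]
    intro l hl
    exact trPair_nondeg _ _ l fun m => by rw [hl]; rfl
  · rw [injective_iff_map_eq_zero]
    intro m hm
    refine trPair_nondeg (fun i => W i 2) (fun i => V i 0) m fun l => ?_
    rw [← trPair_comm, ← LinearMap.flip_apply, hm]; rfl
  · intro l
    rw [mem_K_iff]
    simp only [pair_d1 s t bar s_bar t_bar eps V W aV aW eW eVinv bar_invol eps_bar]
    have he : ∀ h, (eps h : ℂ) ≠ 0 := by
      intro h
      rcases eps_pm h with h | h <;> simp [h]
    constructor
    · intro H ψ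
      simp [trPair_apply, H]
    · intro H h
      have := congrFun (trPair_nondeg _ _ _ H) h
      exact (smul_eq_zero.1 this).resolve_left (he h)
end
end
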